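/- arXiv:1812.01692 — 8 statements merged into one kernel-verified Lean document; each statement's English description precedes it below -/
import Mathlib

section
/- Let m be an even positive integer and let π be a pair partition of [m] that has a crossing, i.e. there exist a < b < π(a) < π(b). Then for every positive integer N and every tuple σ⃗ = (σ₁,…,σ_m) of permutations of [N]×[N], the count C_N(π,σ⃗) satisfies C_N(π,σ⃗) ≤ N^{m/2}; equivalently V_N(π,σ⃗) ≤ 1/N. -/
open Filter Topology

/-- The swap (transpose) map `t(a,b) = (b,a)` on pairs. -/
def swapPair {α : Type*} : α × α → α × α := fun p => (p.2, p.1)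

/-- The conjugation `t ∘ μ ∘ t` of a permutation of pairs by the swap `t`. -/
def conjT {α : Type*} (μ : Equiv.Perm (α × α)) : Equiv.Perm (α × α) :=
  (Equiv.prodComm α α).trans (μ.trans (Equiv.prodComm α α))

/-- `C_N(π, σ⃗)`: the number of tuples `(i₁, …, i_m) ∈ [N]^m` (here `i : Fin m → α`)
such that `σ_k(i_k, i_{k+1}) = t(σ_{π(k)}(i_{π(k)}, i_{π(k)+1}))` for all `k`,
indices read cyclically. -/
noncomputable def pairCount {α : Type*} (m : ℕ) (π : Equiv.Perm (Fin m))
    (σ : Fin m → Equiv.Perm (α × α)) : ℕ :=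
  Nat.card {i : Fin m → α // ∀ k : Fin m,
    σ k (i k, i (finRotate m k)) = swapPair ((σ (π k)) (i (π k), i (finRotate m (π k))))}

/-- `V_N(π, σ⃗) = N^{-m/2-1} C_N(π, σ⃗)`. -/
noncomputable def Vval (m N : ℕ) (π : Equiv.Perm (Fin m))
    (σ : Fin m → Equiv.Perm (Fin N × Fin N)) : ℝ :=
  (pairCount m π σ : ℝ) / (N : ℝ) ^ (m / 2 + 1)

/-- `𝔧(σ : τ) = #{(i,j,k) : σ(i,j) = (t∘τ∘t)(k,j)}`. -/
noncomputable def jcount {α : Type*} (σ τ : Equiv.Perm (α × α)) : ℕ :=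
  Nat.card {x : α × α × α // σ (x.1, x.2.1) = (conjT τ) (x.2.2, x.2.1)}

/-- The count in condition (ii) of the main theorem:
`#{(i,j,k) : σ(i,j) ∈ {μ(i,k), μ(k,j), (t∘μ∘t)(i,k), (t∘μ∘t)(k,j)}}`. -/
noncomputable def mixCount {α : Type*} (σ μ : Equiv.Perm (α × α)) : ℕ :=
  Nat.card {x : α × α × α //
    σ (x.1, x.2.1) = μ (x.1, x.2.2) ∨ σ (x.1, x.2.1) = μ (x.2.2, x.2.1) ∨
    σ (x.1, x.2.1) = conjT μ (x.1, x.2.2) ∨ σ (x.1, x.2.1) = conjT μ (x.2.2, x.2.1)}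

/-- `𝔠(φ, ψ) = #{i : φ(i) = ψ(i)}`. -/
noncomputable def fixCount {α : Type*} (φ ψ : Equiv.Perm α) : ℕ := Nat.card {i : α // φ i = ψ i}

theorem swapPair_injective {α : Type*} : Function.Injective (swapPair (α := α)) := by
  rintro ⟨a, b⟩ ⟨c, d⟩ h
  simp only [swapPair, Prod.mk.injEq] at h ⊢
  exact ⟨h.2, h.1⟩

theorem val_finRotate {m : ℕ} (k : Fin m) :
    (finRotate m k : ℕ) = if (k : ℕ) + 1 = m then 0 else (k : ℕ) + 1 := by
  obtain _ | n := m
  · exact k.elim0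
  · rw [coe_finRotate]
    simp only [Fin.ext_iff, Fin.val_last]
    split_ifs <;> omega

/-- A set of positions is closed under `π` if whenever it contains both endpoints of the edge
`(k, k + 1)`, it also contains both endpoints of the edge paired with it. -/
def IsPairClosed {m : ℕ} (π : Equiv.Perm (Fin m)) (K : Set (Fin m)) : Prop :=
  ∀ k, k ∈ K → finRotate m k ∈ K → π k ∈ K ∧ finRotate m (π k) ∈ K

/-- If the only closed set containing `F` is everything, then a solution of the defining equations
of `pairCount` is determined by its values on `F`. -/
theorem pairCount_le_pow_card {m N : ℕ} (π : Equiv.Perm (Fin m))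
    (σ : Fin m → Equiv.Perm (Fin N × Fin N)) (F : Finset (Fin m))
    (hF : ∀ K : Set (Fin m), IsPairClosed π K → ↑F ⊆ K → ∀ k, k ∈ K) :
    pairCount m π σ ≤ N ^ F.card := by
  have hcard : Nat.card (F → Fin N) = N ^ F.card := by simp
  rw [← hcard, pairCount]
  refine Nat.card_le_card_of_injective (fun x (v : F) => x.1 v) ?_
  rintro ⟨x, hx⟩ ⟨y, hy⟩ hxy
  refine Subtype.ext (funext (hF {v | x v = y v} ?_ fun v hv => congrFun hxy ⟨v, hv⟩))
  intro k hk hk'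
  simp only [Set.mem_ofPred_eq] at hk hk' ⊢
  have h := hx k
  rw [hk, hk', hy k] at h
  have h' := (σ (π k)).injective (swapPair_injective h)
  rw [Prod.mk.injEq] at h'
  exact ⟨h'.1.symm, h'.2.symm⟩

/-- The number of elements preceding their partner, for any ranking. -/
theorem two_mul_card_filter_rank_lt_le {m : ℕ} (π : Equiv.Perm (Fin m)) (hinv : ∀ k, π (π k) = k)
    (r : Fin m → ℕ) : 2 * (Finset.univ.filter fun k => r k < r (π k)).card ≤ m := by
  set S := Finset.univ.filter fun k => r k < r (π k) with hS
  have hdisj : Disjoint S (S.map π.toEmbedding) := by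
    rw [Finset.disjoint_left]
    intro k hk hk'
    obtain ⟨l, hl, rfl⟩ := Finset.mem_map.1 hk'
    simp only [hS, Finset.mem_filter, Finset.mem_univ, true_and, Equiv.coe_toEmbedding,
      hinv] at hk hl
    omega
  have h := Finset.card_le_univ (S.disjUnion _ hdisj)
  rw [Finset.card_disjUnion, Finset.card_map, Fintype.card_fin] at h
  omega

/-- The order in which the edges are explored: forward from `A` up to `B`, then backward from `C`
down to `B`, then the edge `B` itself, and finally forward from `C` around the cycle. -/
def crossingRank (m A B C k : ℕ) : ℕ :=
  if k < A then k + m - A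
  else if k < B then k - A
  else if k = B then C - A - 1
  else if k < C then (B - A) + (C - 1 - k)
  else k - A

/-- The endpoint of the edge `(k, k + 1)` that is met last in the exploration order. -/
def crossingEndpoint {m : ℕ} (b c k : Fin m) : Fin m :=
  if b < k ∧ k < c then k else finRotate m k

/-- The starting position, and the new endpoints of all edges other than `b` that are explored
before their partner. -/
def crossingFree {m : ℕ} (π : Equiv.Perm (Fin m)) (a b : Fin m) : Finset (Fin m) :=
  insert a (((Finset.univ.filter fun k : Fin m =>
    crossingRank m a b (π a) k < crossingRank m a b (π a) (π k)).erase b).image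
      (crossingEndpoint b (π a)))

theorem card_crossingFree_le {m : ℕ} (π : Equiv.Perm (Fin m)) (hinv : ∀ k, π (π k) = k)
    (a b : Fin m) (hab : a < b) (hbπa : b < π a) (hπaπb : π a < π b) :
    (crossingFree π a b).card ≤ m / 2 := by
  have h2 := two_mul_card_filter_rank_lt_le π hinv fun k => crossingRank m a b (π a) k
  have hb : b ∈ Finset.univ.filter fun k : Fin m =>
      crossingRank m a b (π a) k < crossingRank m a b (π a) (π k) := by
    refine Finset.mem_filter.2 ⟨Finset.mem_univ _, ?_⟩
    simp only [crossingRank]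
    split_ifs <;> omega
  have hpos := Finset.card_pos.2 ⟨b, hb⟩
  have herase := Finset.card_erase_of_mem hb
  have hinsert := (Finset.card_insert_le a _).trans
    (Nat.add_le_add_right (Finset.card_image_le (s := (Finset.univ.filter fun k : Fin m =>
      crossingRank m a b (π a) k < crossingRank m a b (π a) (π k)).erase b)
      (f := crossingEndpoint b (π a))) 1)
  unfold crossingFree
  omega

theorem mem_of_crossingFree_subset {m : ℕ} (π : Equiv.Perm (Fin m)) (hinv : ∀ k, π (π k) = k)
    (hfix : ∀ k, π k ≠ k) (a b : Fin m) (hab : a < b) (hbπa : b < π a) (hπaπb : π a < π b)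
    (K : Set (Fin m)) (hK : IsPairClosed π K) (hF : ↑(crossingFree π a b) ⊆ K) (k : Fin m) :
    k ∈ K := by
  set r : Fin m → ℕ := fun k => crossingRank m a b (π a) k with hr
  suffices h : ∀ n, ∀ e, r e = n → e ∈ K ∧ finRotate m e ∈ K from (h _ k rfl).1
  intro n
  induction n using Nat.strong_induction_on with
  | _ n ih =>
  intro e he
  have ih' : ∀ f, r f < r e → f ∈ K ∧ finRotate m f ∈ K := fun f hf => ih _ (he ▸ hf) f rfl
  have haK : a ∈ K := hF (by simp [crossingFree])
  have hnew : r e < r (π e) → e ≠ b → crossingEndpoint b (π a) e ∈ K := fun h hne =>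
    hF (Finset.mem_insert_of_mem (Finset.mem_image_of_mem _
      (Finset.mem_erase.2 ⟨hne, Finset.mem_filter.2 ⟨Finset.mem_univ _, h⟩⟩)))
  have ha0 : r a = 0 := by simp only [hr, crossingRank]; split_ifs <;> omega
  have hπa : 0 < r e → π a ∈ K := fun h =>
    (hK a (ih' a (ha0 ▸ h)).1 (ih' a (ha0 ▸ h)).2).1
  have hstep : ∀ f, r f < r e → finRotate m f = e → e ∈ K := fun f hf h => h ▸ (ih' f hf).2
  have hstart : ¬ (b < e ∧ e < π a) → e ≠ π a → e ∈ K := by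
    intro h1 h2
    by_cases hea : e = a
    · exact hea ▸ haK
    by_cases he0 : (e : ℕ) = 0
    · refine hstep ⟨m - 1, by omega⟩ ?_ (Fin.ext ?_)
      · simp only [hr, crossingRank]; split_ifs <;> omega
      · rw [val_finRotate]; simp only; split_ifs <;> omega
    · refine hstep ⟨e - 1, by omega⟩ ?_ (Fin.ext ?_)
      · simp only [hr, crossingRank]; split_ifs <;> omega
      · rw [val_finRotate]; simp only; split_ifs <;> omega
  have hend : b ≤ e → e < π a → finRotate m e ∈ K := by
    intro h1 h2
    have hval := val_finRotate e
    rw [if_neg (by omega)] at hval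
    by_cases h3 : (e : ℕ) + 1 = π a
    · rw [show finRotate m e = π a from Fin.ext (hval.trans h3)]
      refine hπa ?_
      simp only [hr, crossingRank]; split_ifs <;> omega
    · refine (ih' _ ?_).1
      simp only [hr, crossingRank, hval]; split_ifs <;> omega
  rcases lt_trichotomy (r e) (r (π e)) with hlt | heq | hgt
  · by_cases heb : e = b
    · exact ⟨hstart (by omega) (by omega), hend (by omega) (by omega)⟩
    have hmem := hnew hlt heb
    unfold crossingEndpoint at hmem
    split_ifs at hmem with hc
    · exact ⟨hmem, hend hc.1.le hc.2⟩
    · refine ⟨hstart hc ?_, hmem⟩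
      rintro rfl
      rw [hinv] at hlt
      omega
  · refine absurd (Fin.ext ?_) (hfix e)
    simp only [hr, crossingRank] at heq
    split_ifs at heq <;> omega
  · have h := ih' (π e) hgt
    simpa only [hinv] using hK (π e) h.1 h.2

/-- if a pair partition `π` of `[m]` has a crossing `a < b < π a < π b`,
then for every positive `N` and every tuple `σ⃗` of permutations of `[N]²`,
`C_N(π, σ⃗) ≤ N^(m/2)`. -/
theorem crossing_pairCount_le (m : ℕ) (hm : Even m) (hm0 : 0 < m)
    (π : Equiv.Perm (Fin m)) (hinv : ∀ k, π (π k) = k) (hfix : ∀ k, π k ≠ k)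
    (a b : Fin m) (hab : a < b) (hbπa : b < π a) (hπaπb : π a < π b)
    (N : ℕ) (hN : 0 < N)
    (σ : Fin m → Equiv.Perm (Fin N × Fin N)) :
    pairCount m π σ ≤ N ^ (m / 2) := by
  exact (pairCount_le_pow_card π σ (crossingFree π a b) fun K hK hF k =>
    mem_of_crossingFree_subset π hinv hfix a b hab hbπa hπaπb K hK hF k).trans
    (Nat.pow_le_pow_right hN (card_crossingFree_le π hinv a b hab hbπa hπaπb))
end

section
/- Let m be an even positive integer and let π be a pair partition of [m] that has a crossing, i.e. there exist a < b < π(a) < π(b). Then for every choice, for each positive integer N, of permutations σ_{1,N},…,σ_{m,N} of [N]×[N], one has V_N(π,(σ_{1,N},…,σ_{m,N})) → 0 as N → ∞. -/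
open Filter Topology

/-- The value at coordinate `v` of a configuration in `X` is determined by its values on `D`. -/
def DeterminedBy {m : ℕ} {α : Type*} (X : Set (Fin m → α)) (D : Finset (Fin m)) (v : Fin m) :
    Prop :=
  ∀ x ∈ X, ∀ y ∈ X, (∀ d ∈ D, x d = y d) → x v = y v

/-- `E` is a `π`-invariant set of edges `k = (k, k + 1)` of the `m`-cycle, all of whose endpoints
are determined by at most `(c + #E) / 2` coordinates. -/
def CheaplyDetermined {m : ℕ} {α : Type*} (X : Set (Fin m → α)) (π : Equiv.Perm (Fin m)) (c : ℕ)
    (E : Finset (Fin m)) : Prop :=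
  (∀ k ∈ E, π k ∈ E) ∧ ∃ D : Finset (Fin m), 2 * D.card ≤ c + E.card ∧
    ∀ k ∈ E, DeterminedBy X D k ∧ DeterminedBy X D (finRotate m k)

/-- In every configuration of `X`, the values on an edge determine the values on its partner. -/
def EdgesLinked {m : ℕ} {α : Type*} (X : Set (Fin m → α)) (π : Equiv.Perm (Fin m)) : Prop :=
  ∀ x ∈ X, ∀ y ∈ X, ∀ k, x k = y k → x (finRotate m k) = y (finRotate m k) →
    x (π k) = y (π k) ∧ x (finRotate m (π k)) = y (finRotate m (π k))

section

variable {m : ℕ} {α : Type*} {X : Set (Fin m → α)} {π : Equiv.Perm (Fin m)}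

lemma DeterminedBy.of_mem {D : Finset (Fin m)} {v : Fin m} (hv : v ∈ D) : DeterminedBy X D v :=
  fun _ _ _ _ h => h v hv

lemma DeterminedBy.mono {D D' : Finset (Fin m)} (hD : D ⊆ D') {v : Fin m}
    (h : DeterminedBy X D v) : DeterminedBy X D' v :=
  fun x hx y hy hxy => h x hx y hy fun d hd => hxy d (hD hd)

lemma EdgesLinked.determinedBy (hX : EdgesLinked X π) {D : Finset (Fin m)} {k : Fin m}
    (h₁ : DeterminedBy X D k) (h₂ : DeterminedBy X D (finRotate m k)) :
    DeterminedBy X D (π k) ∧ DeterminedBy X D (finRotate m (π k)) :=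
  ⟨fun x hx y hy h => (hX x hx y hy k (h₁ x hx y hy h) (h₂ x hx y hy h)).1,
    fun x hx y hy h => (hX x hx y hy k (h₁ x hx y hy h) (h₂ x hx y hy h)).2⟩

lemma card_insert_pair (hinv : ∀ k, π (π k) = k) (hfix : ∀ k, π k ≠ k) {E : Finset (Fin m)}
    (hE : ∀ k ∈ E, π k ∈ E) {k : Fin m} (hk : k ∉ E) :
    (insert k (insert (π k) E)).card = E.card + 2 := by
  have h : π k ∉ E := fun h => hk (hinv k ▸ hE _ h)
  rw [Finset.card_insert_of_notMem, Finset.card_insert_of_notMem h]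
  simp [hk, (hfix k).symm]

/-- A block both of whose endpoints are determined by `D` may be adjoined to `E`. -/
lemma EdgesLinked.cheaplyDetermined_insert (hX : EdgesLinked X π) (hinv : ∀ k, π (π k) = k)
    (hfix : ∀ k, π k ≠ k) {c : ℕ} {E D : Finset (Fin m)} (hE : ∀ k ∈ E, π k ∈ E) {k : Fin m}
    (hk : k ∉ E) (hD : 2 * D.card ≤ c + (E.card + 2))
    (hdet : ∀ k ∈ E, DeterminedBy X D k ∧ DeterminedBy X D (finRotate m k))
    (h₁ : DeterminedBy X D k) (h₂ : DeterminedBy X D (finRotate m k)) :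
    CheaplyDetermined X π c (insert k (insert (π k) E)) := by
  refine ⟨?_, D, ?_, ?_⟩
  · simp only [Finset.mem_insert]
    rintro l (rfl | rfl | hl)
    · simp
    · simp [hinv]
    · exact Or.inr (Or.inr (hE l hl))
  · rwa [card_insert_pair hinv hfix hE hk]
  · simp only [Finset.mem_insert]
    rintro l (rfl | rfl | hl)
    · exact ⟨h₁, h₂⟩
    · exact hX.determinedBy h₁ h₂
    · exact hdet l hl

/-- A block touching `E` may be adjoined to `E` at the cost of one more coordinate. -/
lemma CheaplyDetermined.insert_adjacent (hX : EdgesLinked X π) (hinv : ∀ k, π (π k) = k)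
    (hfix : ∀ k, π k ≠ k) {c : ℕ} {E : Finset (Fin m)} (h : CheaplyDetermined X π c E)
    {k l : Fin m} (hl : l ∈ E) (hkl : k = finRotate m l ∨ l = finRotate m k) (hk : k ∉ E) :
    CheaplyDetermined X π c (insert k (insert (π k) E)) := by
  obtain ⟨hE, D, hD, hdet⟩ := h
  have key : ∀ v, (DeterminedBy X (insert v D) k) →
      (DeterminedBy X (insert v D) (finRotate m k)) →
      CheaplyDetermined X π c (insert k (insert (π k) E)) := by
    intro v h₁ h₂
    have hc := Finset.card_insert_le v D
    exact hX.cheaplyDetermined_insert hinv hfix hE hk (by omega)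
      (fun j hj => ⟨(hdet j hj).1.mono (Finset.subset_insert _ _),
        (hdet j hj).2.mono (Finset.subset_insert _ _)⟩) h₁ h₂
  rcases hkl with rfl | rfl
  · exact key _ ((hdet l hl).2.mono (Finset.subset_insert _ _))
      (.of_mem (Finset.mem_insert_self _ _))
  · exact key _ (.of_mem (Finset.mem_insert_self _ _))
      ((hdet _ hl).1.mono (Finset.subset_insert _ _))

lemma finRotate_eq_of_val_eq {k l : Fin m} (h : (l : ℕ) = k + 1) : finRotate m k = l := by
  cases m with
  | zero => exact k.elim0
  | succ n =>
    have hk : (k : ℕ) < n := by have := l.isLt; omega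
    ext
    rw [coe_finRotate_of_ne_last (by rintro rfl; simp at hk), h]

lemma eq_univ_of_finRotate_mem {E : Finset (Fin m)} (hne : E.Nonempty)
    (h : ∀ k ∈ E, finRotate m k ∈ E) : E = Finset.univ := by
  cases m with
  | zero => obtain ⟨k, -⟩ := hne; exact k.elim0
  | succ n =>
    obtain ⟨b, hb⟩ := hne
    have up : ∀ l ∈ E, ∀ j : ℕ, ∀ k : Fin (n + 1), (k : ℕ) = l + j → k ∈ E := by
      intro l hl j
      induction j with
      | zero => intro k hk; rwa [show k = l from Fin.ext (by simpa using hk)]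
      | succ j ih =>
        intro k hk
        have hlt := k.isLt
        have := h _ (ih ⟨l + j, by omega⟩ rfl)
        rwa [finRotate_eq_of_val_eq (l := k) (by simp only; omega)] at this
    have hlast : Fin.last n ∈ E := up b hb (n - b) _ (by have := b.isLt; simp; omega)
    have h0 : (0 : Fin (n + 1)) ∈ E := by simpa using h _ hlast
    exact Finset.eq_univ_of_forall fun k => up 0 h0 k k (by simp)

/-- If `π` has a crossing, some `m / 2` coordinates determine every configuration of `X`: starting
from the block of `a`, both endpoints of the edge `b` get determined without paying for `b`. -/
lemma EdgesLinked.exists_determining (hX : EdgesLinked X π) (hinv : ∀ k, π (π k) = k)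
    (hfix : ∀ k, π k ≠ k) {a b : Fin m} (hab : a < b) (hbπa : b < π a) (hπaπb : π a < π b) :
    ∃ D : Finset (Fin m), 2 * D.card ≤ m ∧ ∀ v, DeterminedBy X D v := by
  have hstart : CheaplyDetermined X π 2 (insert a (insert (π a) ∅)) :=
    hX.cheaplyDetermined_insert hinv hfix (D := {a, finRotate m a}) (by simp) (by simp)
      (by have := Finset.card_le_two (a := a) (b := finRotate m a)
          rw [Finset.card_empty]; omega)
      (by simp)
      (.of_mem (by simp)) (.of_mem (by simp))
  obtain ⟨E, hsub, ⟨hE, hbE⟩, hmax⟩ :=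
    (Set.toFinite {E | CheaplyDetermined X π 2 E ∧ b ∉ E}).exists_le_maximal
      (a := insert a (insert (π a) ∅)) ⟨hstart, by simp [hab.ne', hbπa.ne]⟩
  have haE : a ∈ E := hsub (by simp)
  have hπaE : π a ∈ E := hsub (by simp)
  have step : ∀ l ∈ E, ∀ k, (k = finRotate m l ∨ l = finRotate m k) → k ≠ b → k ≠ π b →
      k ∈ E := by
    intro l hl k hkl hkb hkπb
    by_contra hk
    refine hk (hmax ⟨hE.insert_adjacent hX hinv hfix hl hkl hk, ?_⟩ ?_ (by simp))
    · simp only [Finset.mem_insert, not_or]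
      exact ⟨hkb.symm, fun h => hkπb (by rw [h, hinv]), hbE⟩
    · exact fun x hx => Finset.mem_insert_of_mem (Finset.mem_insert_of_mem hx)
  rw [Fin.lt_def] at hab hbπa hπaπb
  have hup : ∀ j : ℕ, ∀ k : Fin m, (k : ℕ) = a + j → (k : ℕ) < b → k ∈ E := by
    intro j
    induction j with
    | zero => intro k hk _; rwa [show k = a from Fin.ext (by simpa using hk)]
    | succ j ih =>
      intro k hk hkb
      refine step _ (ih ⟨a + j, by omega⟩ rfl (by simp only; omega)) k
        (Or.inl (finRotate_eq_of_val_eq (by simp only; omega)).symm) ?_ ?_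
      · rintro rfl; omega
      · rintro rfl; omega
  have hdown : ∀ j : ℕ, ∀ k : Fin m, (k : ℕ) + j = π a → (b : ℕ) < k → k ∈ E := by
    intro j
    induction j with
    | zero => intro k hk _; rwa [show k = π a from Fin.ext (by simpa using hk)]
    | succ j ih =>
      intro k hk hkb
      have hlt := (π a).isLt
      refine step _ (ih ⟨k + 1, by omega⟩ (by simp only; omega) (by simp only; omega)) k
        (Or.inr (finRotate_eq_of_val_eq (by simp only)).symm) ?_ ?_
      · rintro rfl; omega
      · rintro rfl; omega
  have hfinal : ∃ E, CheaplyDetermined X π 0 E ∧ b ∈ E := by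
    obtain ⟨hπE, D, hD, hdet⟩ := hE
    have hbm := b.isLt
    have hπa := (π a).isLt
    refine ⟨_, hX.cheaplyDetermined_insert hinv hfix hπE hbE (by omega) hdet ?_ ?_,
      Finset.mem_insert_self _ _⟩
    · rw [← finRotate_eq_of_val_eq (k := ⟨b - 1, by omega⟩) (l := b) (by simp only; omega)]
      exact (hdet _ (hup (b - 1 - a) _ (by simp only; omega) (by simp only; omega))).2
    · rw [finRotate_eq_of_val_eq (k := b) (l := ⟨b + 1, by omega⟩) rfl]
      exact (hdet _ (hdown (π a - (b + 1)) _ (by simp only; omega) (by simp only; omega))).1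
  obtain ⟨E₀, hE₀, hbE₀⟩ := hfinal
  obtain ⟨E', hsub', hE', hmax'⟩ :=
    (Set.toFinite {E | CheaplyDetermined X π 0 E}).exists_le_maximal (a := E₀) hE₀
  have huniv : E' = Finset.univ := by
    refine eq_univ_of_finRotate_mem ⟨b, hsub' hbE₀⟩ fun k hk => ?_
    by_contra hk'
    exact hk' (hmax' (CheaplyDetermined.insert_adjacent hX hinv hfix hE' hk (Or.inl rfl) hk')
      (fun x hx => Finset.mem_insert_of_mem (Finset.mem_insert_of_mem hx)) (by simp))
  obtain ⟨-, D, hD, hdet⟩ := hE'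
  refine ⟨D, by simpa [huniv] using hD, fun v => (hdet v (by simp [huniv])).1⟩

end

/-- The count of a crossing pair partition loses a full factor `N`. -/
lemma pairCount_le_of_crossing {m N : ℕ} {π : Equiv.Perm (Fin m)} (hinv : ∀ k, π (π k) = k)
    (hfix : ∀ k, π k ≠ k) {a b : Fin m} (hab : a < b) (hbπa : b < π a) (hπaπb : π a < π b)
    (hN : 0 < N) (σ : Fin m → Equiv.Perm (Fin N × Fin N)) :
    pairCount m π σ ≤ N ^ (m / 2) := by
  set X : Set (Fin m → Fin N) := {i | ∀ k : Fin m,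
    σ k (i k, i (finRotate m k)) =
      swapPair ((σ (π k)) (i (π k), i (finRotate m (π k))))} with hXdef
  have hX : EdgesLinked X π := by
    intro x hx y hy k h₁ h₂
    have h := hx k
    rw [h₁, h₂, hy k] at h
    have h' := (σ (π k)).injective (Prod.swap_injective h)
    simp only [Prod.mk.injEq] at h'
    exact ⟨h'.1.symm, h'.2.symm⟩
  obtain ⟨D, hD, hdet⟩ := hX.exists_determining hinv hfix hab hbπa hπaπb
  have hinj : Function.Injective (fun (x : X) (d : D) => x.1 d) := by
    intro x y hxy
    ext1
    funext v
    exact hdet v x x.2 y y.2 fun d hd => congrFun hxy ⟨d, hd⟩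
  calc pairCount m π σ = Nat.card X := rfl
    _ ≤ Nat.card (D → Fin N) := Nat.card_le_card_of_injective _ hinj
    _ = N ^ D.card := by simp
    _ ≤ N ^ (m / 2) := Nat.pow_le_pow_right hN (by omega)

/-- if a pair partition `π` of `[m]` has a crossing `a < b < π a < π b`,
then for every choice, for each `N`, of permutations `σ_{1,N}, …, σ_{m,N}` of `[N]²`,
`V_N(π, σ⃗_N) → 0` as `N → ∞`. -/
theorem crossing_Vval_tendsto_zero (m : ℕ) (hm : Even m) (hm0 : 0 < m)
    (π : Equiv.Perm (Fin m)) (hinv : ∀ k, π (π k) = k) (hfix : ∀ k, π k ≠ k)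
    (a b : Fin m) (hab : a < b) (hbπa : b < π a) (hπaπb : π a < π b)
    (σ : ∀ N : ℕ, Fin m → Equiv.Perm (Fin N × Fin N)) :
    Tendsto (fun N : ℕ => Vval m N π (σ N)) atTop (nhds 0) := by
  refine squeeze_zero' (Eventually.of_forall fun N => ?_) ?_
    (tendsto_one_div_atTop_nhds_zero_nat (𝕜 := ℝ))
  · unfold Vval
    positivity
  · filter_upwards [eventually_gt_atTop 0] with N hN
    have hN' : (0 : ℝ) < N := by exact_mod_cast hN
    have h : (pairCount m π (σ N) : ℝ) ≤ (N : ℝ) ^ (m / 2) := by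
      exact_mod_cast pairCount_le_of_crossing hinv hfix hab hbπa hπaπb hN (σ N)
    rw [Vval, div_le_div_iff₀ (by positivity) hN', one_mul, pow_succ]
    gcongr
end

section
/- Let m be an even positive integer and let π be a noncrossing pair partition of [m] with π(k) = k+1 for some 1 ≤ k ≤ m−1. Then for every positive integer N and all permutations σ₁,…,σ_m of [N]×[N], C_N(π,σ⃗) ≤ N^{m/2−1} · 𝔧(σ_k : σ_{k+1}). -/
open Filter Topology

/-- A rank function injective on the points of a fixed-point-free involution picks exactly one
point (the opener) of each orbit. -/
theorem two_mul_card_openers {ι : Type*} [Fintype ι] (π : Equiv.Perm ι)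
    (hinv : ∀ k, π (π k) = k) (hfix : ∀ k, π k ≠ k) (r : ι → ℕ) (hr : Function.Injective r) :
    2 * (Finset.univ.filter fun l => r l < r (π l)).card = Fintype.card ι := by
  have hcard : (Finset.univ.filter fun l => r l < r (π l)).card =
      (Finset.univ.filter fun l => ¬ r l < r (π l)).card := by
    refine Finset.card_bij (fun l _ => π l) ?_ (fun a _ b _ h => π.injective h) ?_
    · intro a ha
      simp only [Finset.mem_filter, Finset.mem_univ, true_and, hinv] at ha ⊢
      omega
    · intro b hb
      simp only [Finset.mem_filter, Finset.mem_univ, true_and] at hb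
      refine ⟨π b, ?_, hinv b⟩
      simp only [Finset.mem_filter, Finset.mem_univ, true_and, hinv]
      have := hr.ne (hfix b)
      omega
  have := Finset.card_filter_add_card_filter_not (s := Finset.univ) (fun l => r l < r (π l))
  rw [← hcard, Finset.card_univ] at this
  omega

/-- Reading the indices cyclically from `k`, a solution of the pairing equations is determined by
`i k`, `i (k + 1)` and the endpoints of the steps that open a pair. -/
theorem eq_of_agree_on_openers {α : Type*} {n : ℕ} (π : Equiv.Perm (Fin (n + 1)))
    (hfix : ∀ k, π k ≠ k) (k : Fin (n + 1)) (σ : Fin (n + 1) → Equiv.Perm (α × α))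
    (i j : Fin (n + 1) → α)
    (hi : ∀ l, σ l (i l, i (l + 1)) = swapPair (σ (π l) (i (π l), i (π l + 1))))
    (hj : ∀ l, σ l (j l, j (l + 1)) = swapPair (σ (π l) (j (π l), j (π l + 1))))
    (hk : i k = j k) (hk' : i (k + 1) = j (k + 1))
    (h : ∀ l, l ≠ k → (l - k).val < (π l - k).val → i (l + 1) = j (l + 1)) : i = j := by
  have key : ∀ N : ℕ, ∀ l, (l - k).val = N → i l = j l ∧ i (l + 1) = j (l + 1) := by
    intro N
    induction N using Nat.strong_induction_on with
    | _ N ih =>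
      intro l hl
      by_cases hlk : l = k
      · subst hlk
        exact ⟨hk, hk'⟩
      have hne : l - k ≠ 0 := sub_ne_zero.mpr hlk
      have hl1 : i l = j l := by
        have hlt : (l - 1 - k).val < N := by
          have hval := Fin.val_sub_one_of_ne_zero hne
          have hpos : (l - k).val ≠ 0 := Fin.val_ne_zero_iff.mpr hne
          rw [show l - 1 - k = l - k - 1 by abel]
          omega
        simpa using (ih _ hlt (l - 1) rfl).2
      refine ⟨hl1, ?_⟩
      rcases lt_trichotomy (l - k).val (π l - k).val with hlt | heq | hgt
      · exact h l hlk hlt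
      · exact absurd (sub_left_injective (Fin.val_injective heq)).symm (hfix l)
      · obtain ⟨h1, h2⟩ := ih _ (hl ▸ hgt) (π l) rfl
        have he := hi l
        rw [h1, h2, ← hj l] at he
        exact congrArg Prod.snd ((σ l).injective he)
  exact funext fun l => (key _ l rfl).1

/-- if `π` is a noncrossing pair partition of `[m]` with `π(k) = k+1`
(for some `1 ≤ k ≤ m-1`, i.e. a genuine, non-cyclic successor), then
`C_N(π, σ⃗) ≤ N^(m/2 - 1) · 𝔧(σ_k : σ_{k+1})`. -/
theorem nc_pairCount_le_jcount (m : ℕ) (hm : Even m) (hm0 : 0 < m)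
    (π : Equiv.Perm (Fin m)) (hinv : ∀ k, π (π k) = k) (hfix : ∀ k, π k ≠ k)
    (hnc : ∀ a b : Fin m, ¬(a < b ∧ b < π a ∧ π a < π b))
    (k : Fin m) (hk : (k : ℕ) + 1 < m)
    (hπk : π k = ⟨(k : ℕ) + 1, hk⟩)
    (N : ℕ) (hN : 0 < N)
    (σ : Fin m → Equiv.Perm (Fin N × Fin N)) :
    pairCount m π σ ≤ N ^ (m / 2 - 1) * jcount (σ k) (σ ⟨(k : ℕ) + 1, hk⟩) := by
  obtain ⟨n, rfl⟩ : ∃ n, m = n + 1 := ⟨m - 1, by omega⟩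
  have hsucc : (⟨(k : ℕ) + 1, hk⟩ : Fin (n + 1)) = k + 1 := by
    ext
    rw [Fin.val_add_one_of_lt (Fin.lt_def.mpr (by simpa using hk))]
  rw [hsucc] at hπk ⊢
  let S := (Finset.univ.filter fun l => (l - k).val < (π l - k).val).erase k
  have hS : S.card = (n + 1) / 2 - 1 := by
    have h2 := two_mul_card_openers π hinv hfix (fun l => (l - k).val)
      (Fin.val_injective.comp sub_left_injective)
    rw [Fintype.card_fin] at h2
    rw [Finset.card_erase_of_mem]
    · omega
    · have : π k - k ≠ 0 := sub_ne_zero.mpr (hfix k)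
      simpa using Fin.pos_iff_ne_zero.mpr this
  let J := {x : Fin N × Fin N × Fin N //
    σ k (x.1, x.2.1) = conjT (σ (k + 1)) (x.2.2, x.2.1)}
  have hJ : Nat.card ((S → Fin N) × J) =
      N ^ ((n + 1) / 2 - 1) * jcount (σ k) (σ (k + 1)) := by
    rw [Nat.card_prod, Nat.card_fun, Nat.card_eq_fintype_card, Nat.card_eq_fintype_card,
      Fintype.card_fin, Fintype.card_coe, hS]
    rfl
  rw [← hJ, pairCount]
  simp only [finRotate_apply]
  refine Nat.card_le_card_of_injective (fun i => (fun l : S => i.1 (l + 1),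
    (⟨(i.1 k, i.1 (k + 1), i.1 (k + 1 + 1)), ?_⟩ : J))) ?_
  · have := i.2 k
    rw [hπk] at this
    exact this
  · rintro ⟨i, hi⟩ ⟨j, hj⟩ hij
    have hopen := congrArg Prod.fst hij
    have htriple := congrArg (fun p => p.2.1) hij
    have h0 : i k = j k := congrArg Prod.fst htriple
    have h1 : i (k + 1) = j (k + 1) := congrArg (fun p => p.2.1) htriple
    refine Subtype.ext (eq_of_agree_on_openers π hfix k σ i j hi hj h0 h1 fun l hlk hl => ?_)
    exact congrFun hopen ⟨l, by simpa [S, hlk] using hl⟩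
end

section
/- Let m be an even positive integer and let π be a noncrossing pair partition of [m] with π(k) = k+1 for some 1 ≤ k ≤ m−1. If for each N permutations σ_{1,N},…,σ_{m,N} of [N]×[N] are given with 𝔧(σ_{k,N} : σ_{k+1,N})/N² → 0 as N → ∞, then V_N(π,(σ_{1,N},…,σ_{m,N})) → 0 as N → ∞. -/
open Filter Topology

/-- Among the pairs of a fixed-point-free involution of `Fin m`, exactly `m / 2` points come before
their partner in the order that an injective `f` induces. -/
lemma card_filter_lt_involution {m : ℕ} (π : Equiv.Perm (Fin m)) (hinv : ∀ k, π (π k) = k)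
    (hfix : ∀ k, π k ≠ k) {f : Fin m → ℕ} (hf : Function.Injective f) :
    (Finset.univ.filter fun s => f s < f (π s)).card = m / 2 := by
  have h := Finset.card_filter_add_card_filter_not (s := (Finset.univ : Finset (Fin m)))
    (fun s => f s < f (π s))
  have h2 : (Finset.univ.filter fun s => f s < f (π s)).card =
      (Finset.univ.filter fun s => ¬ f s < f (π s)).card := by
    refine Finset.card_bij (fun s _ => π s) ?_ ?_ ?_
    · intro s hs
      simp only [Finset.mem_filter, Finset.mem_univ, true_and, hinv] at hs ⊢
      omega
    · intro a _ b _ hab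
      exact π.injective hab
    · intro s hs
      refine ⟨π s, ?_, hinv s⟩
      simp only [Finset.mem_filter, Finset.mem_univ, true_and, hinv] at hs ⊢
      have hne : f (π s) ≠ f s := fun h => hfix s (hf h)
      omega
  rw [Finset.card_univ, Fintype.card_fin] at h
  omega

/-- Two solutions of the pairing equations agree once they agree at `k` and just after every edge
which, reading cyclically from `k`, precedes its partner. -/
lemma eq_of_eq_on_openers {α : Type*} {n : ℕ} (π : Equiv.Perm (Fin (n + 1)))
    (hfix : ∀ k, π k ≠ k) (σ : Fin (n + 1) → Equiv.Perm (α × α)) {i i' : Fin (n + 1) → α}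
    (hi : ∀ s, σ s (i s, i (s + 1)) = swapPair (σ (π s) (i (π s), i (π s + 1))))
    (hi' : ∀ s, σ s (i' s, i' (s + 1)) = swapPair (σ (π s) (i' (π s), i' (π s + 1))))
    (k : Fin (n + 1)) (h0 : i k = i' k)
    (hO : ∀ s : Fin (n + 1), (s - k).val < (π s - k).val → i (s + 1) = i' (s + 1)) : i = i' := by
  suffices H : ∀ p : ℕ, ∀ s : Fin (n + 1), (s - k).val = p → i s = i' s from
    funext fun s => H _ s rfl
  intro p
  induction p using Nat.strong_induction_on with
  | _ p ih =>
  intro s hs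
  by_cases hsk : s - k = 0
  · rw [sub_eq_zero.mp hsk, h0]
  obtain ⟨r, rfl⟩ : ∃ r, s = r + 1 := ⟨s - 1, by simp⟩
  have hr : (r - k).val + 1 = p := by
    have h := Fin.val_sub_one_of_ne_zero hsk
    rw [show r + 1 - k - 1 = r - k by abel] at h
    have := Fin.val_ne_zero_iff.mpr hsk
    omega
  by_cases hro : (r - k).val < (π r - k).val
  · exact hO r hro
  have hne : (π r - k).val ≠ (r - k).val := fun h =>
    hfix r (sub_left_injective (Fin.ext h))
  have hlt : (π r - k).val < (r - k).val := by omega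
  have hpos : (π r + 1 - k).val = (π r - k).val + 1 := by
    rw [show π r + 1 - k = π r - k + 1 by abel]
    refine Fin.val_add_one_of_lt ?_
    rw [Fin.lt_def, Fin.val_last]
    have := (r - k).isLt
    omega
  have e1 := ih _ (by omega) (π r) rfl
  have e2 := ih _ (by omega) (π r + 1) rfl
  have h := (hi r).trans ((by rw [e1, e2] : _ = _).trans (hi' r).symm)
  exact (Prod.ext_iff.mp ((σ r).injective h)).2

/-- A pair `{k, k + 1}` bounds the count by `𝔧(σ_k : σ_{k+1})` times one free index for each of the
other pairs. -/
lemma pairCount_le_jcount_mul {α : Type*} [Finite α] {m : ℕ} (π : Equiv.Perm (Fin m))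
    (hinv : ∀ k, π (π k) = k) (hfix : ∀ k, π k ≠ k) (k : Fin m) (hk : (k : ℕ) + 1 < m)
    (hπk : π k = ⟨(k : ℕ) + 1, hk⟩) (σ : Fin m → Equiv.Perm (α × α)) :
    pairCount m π σ ≤ jcount (σ k) (σ ⟨(k : ℕ) + 1, hk⟩) * Nat.card α ^ (m / 2 - 1) := by
  obtain ⟨n, rfl⟩ : ∃ n, m = n + 1 := ⟨m - 1, by omega⟩
  have hk1 : (⟨(k : ℕ) + 1, hk⟩ : Fin (n + 1)) = k + 1 := by
    refine Fin.ext (Fin.val_add_one_of_lt ?_).symm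
    rw [Fin.lt_def, Fin.val_last]
    omega
  rw [hk1] at hπk ⊢
  set O := (Finset.univ.filter fun s : Fin (n + 1) => (s - k).val < (π s - k).val).erase k with hO
  have hcard : O.card = (n + 1) / 2 - 1 := by
    rw [hO, Finset.card_erase_of_mem, card_filter_lt_involution π hinv hfix
      (f := fun s => (s - k).val) fun a b h => sub_left_injective (Fin.ext h)]
    simp only [Finset.mem_filter, Finset.mem_univ, true_and, sub_self, Fin.val_zero]
    exact Nat.pos_of_ne_zero (Fin.val_ne_zero_iff.mpr (sub_ne_zero.mpr (hfix k)))
  have hfun : Nat.card (O → α) = Nat.card α ^ ((n + 1) / 2 - 1) := by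
    rw [Nat.card_fun, Nat.card_eq_finsetCard, hcard]
  rw [← hfun, jcount, pairCount, ← Nat.card_prod]
  simp only [finRotate_apply]
  refine Nat.card_le_card_of_injective
    (fun i => (⟨(i.1 k, i.1 (k + 1), i.1 (k + 1 + 1)), ?_⟩, fun s : O => i.1 (s.1 + 1))) ?_
  · have h := i.2 k
    rw [hπk] at h
    exact h
  · rintro ⟨i, hi⟩ ⟨i', hi'⟩ h
    have h0 : i k = i' k := congrArg (fun x => x.1.1.1) h
    have h1 : i (k + 1) = i' (k + 1) := congrArg (fun x => x.1.1.2.1) h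
    have hs := congrArg Prod.snd h
    refine Subtype.ext (eq_of_eq_on_openers π hfix σ hi hi' k h0 fun s hlt => ?_)
    by_cases hsk : s = k
    · exact hsk ▸ h1
    · exact congrFun hs ⟨s, Finset.mem_erase.mpr ⟨hsk, Finset.mem_filter.mpr ⟨Finset.mem_univ s, hlt⟩⟩⟩

/-- if `π` is a noncrossing pair partition of `[m]` with `π(k) = k+1`
for some `1 ≤ k ≤ m-1`, and for each `N` permutations `σ_{1,N}, …, σ_{m,N}` of `[N]²`
are given with `𝔧(σ_{k,N} : σ_{k+1,N})/N² → 0`, then `V_N(π, σ⃗_N) → 0`. -/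
theorem nc_Vval_tendsto_zero (m : ℕ) (hm : Even m) (hm0 : 0 < m)
    (π : Equiv.Perm (Fin m)) (hinv : ∀ k, π (π k) = k) (hfix : ∀ k, π k ≠ k)
    (hnc : ∀ a b : Fin m, ¬(a < b ∧ b < π a ∧ π a < π b))
    (k : Fin m) (hk : (k : ℕ) + 1 < m)
    (hπk : π k = ⟨(k : ℕ) + 1, hk⟩)
    (σ : ∀ N : ℕ, Fin m → Equiv.Perm (Fin N × Fin N))
    (hj : Tendsto (fun N : ℕ =>
      (jcount (σ N k) (σ N ⟨(k : ℕ) + 1, hk⟩) : ℝ) / (N : ℝ) ^ 2) atTop (nhds 0)) :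
    Tendsto (fun N : ℕ => Vval m N π (σ N)) atTop (nhds 0) := by
  have hm2 : 2 ≤ m := by omega
  refine tendsto_of_tendsto_of_tendsto_of_le_of_le' tendsto_const_nhds hj
    (Eventually.of_forall fun N => by unfold Vval; positivity) ?_
  filter_upwards [eventually_gt_atTop 0] with N hN
  have hN' : (0 : ℝ) < N := by exact_mod_cast hN
  have h := pairCount_le_jcount_mul π hinv hfix k hk hπk (σ N)
  rw [Nat.card_fin] at h
  have h' : (pairCount m π (σ N) : ℝ) ≤
      jcount (σ N k) (σ N ⟨(k : ℕ) + 1, hk⟩) * (N : ℝ) ^ (m / 2 - 1) := by exact_mod_cast h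
  rw [Vval, div_le_div_iff₀ (by positivity) (by positivity)]
  calc (pairCount m π (σ N) : ℝ) * (N : ℝ) ^ 2
      ≤ jcount (σ N k) (σ N ⟨(k : ℕ) + 1, hk⟩) * (N : ℝ) ^ (m / 2 - 1) * (N : ℝ) ^ 2 := by gcongr
    _ = jcount (σ N k) (σ N ⟨(k : ℕ) + 1, hk⟩) * (N : ℝ) ^ (m / 2 + 1) := by
      rw [mul_assoc, ← pow_add, show m / 2 - 1 + 2 = m / 2 + 1 by omega]
end

section
/- For every positive integer N and all permutations φ₁, ψ₁, φ₂, ψ₂ of [N], one has 𝔧(φ₁⊗ψ₁ : t∘(φ₂⊗ψ₂)) = N and 𝔧(φ₁⊗ψ₁ : (φ₂⊗ψ₂)∘t) = N. -/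
open Filter Topology

/-- If the matching condition determines `i` and `k` from `j`, then `𝔧` counts the values of `j`. -/
theorem jcount_eq_card_of_iff {α : Type*} {σ τ : Equiv.Perm (α × α)} (f g : α → α)
    (h : ∀ i j k, σ (i, j) = conjT τ (k, j) ↔ i = f j ∧ k = g j) :
    jcount σ τ = Nat.card α :=
  Nat.card_congr
    { toFun := fun x => x.1.2.1
      invFun := fun j => ⟨(f j, j, g j), (h _ _ _).2 ⟨rfl, rfl⟩⟩
      left_inv := by
        rintro ⟨⟨i, j, k⟩, hx⟩
        obtain ⟨rfl, rfl⟩ := (h i j k).1 hx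
        rfl
      right_inv := fun _ => rfl }

/-- for permutations `φ₁, ψ₁, φ₂, ψ₂` of `[N]`,
`𝔧(φ₁⊗ψ₁ : t∘(φ₂⊗ψ₂)) = N` and `𝔧(φ₁⊗ψ₁ : (φ₂⊗ψ₂)∘t) = N`. -/
theorem jcount_tensor_swap (N : ℕ) (hN : 0 < N) (φ₁ ψ₁ φ₂ ψ₂ : Equiv.Perm (Fin N)) :
    jcount (Equiv.prodCongr φ₁ ψ₁)
      ((Equiv.prodCongr φ₂ ψ₂).trans (Equiv.prodComm (Fin N) (Fin N))) = N ∧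
    jcount (Equiv.prodCongr φ₁ ψ₁)
      ((Equiv.prodComm (Fin N) (Fin N)).trans (Equiv.prodCongr φ₂ ψ₂)) = N := by
  constructor
  · rw [jcount_eq_card_of_iff (fun j => φ₁.symm (φ₂ j)) (fun j => ψ₂.symm (ψ₁ j)), Nat.card_fin]
    intro i j k
    simp [conjT, Equiv.eq_symm_apply, eq_comm]
  · rw [jcount_eq_card_of_iff (fun j => φ₁.symm (ψ₂ j)) (fun j => φ₂.symm (ψ₁ j)), Nat.card_fin]
    intro i j k
    simp [conjT, Equiv.eq_symm_apply, eq_comm]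
end

section
/- For every positive integer N and all permutations φ₁, ψ₁, φ₂, ψ₂ of [N], one has #{(i,j,k) ∈ [N]³ : (φ₁⊗ψ₁)(i,j) ∈ {(φ₂⊗ψ₂)(i,k), (φ₂⊗ψ₂)(k,j), (ψ₂⊗φ₂)(i,k), (ψ₂⊗φ₂)(k,j)}} ≤ N · (𝔠(φ₁,φ₂) + 𝔠(φ₁,ψ₂) + 𝔠(ψ₁,φ₂) + 𝔠(ψ₁,ψ₂)). (Note that ψ₂⊗φ₂ = t∘(φ₂⊗ψ₂)∘t, so this bounds the quantity appearing in condition (ii) of the main theorem for the pair of permutations φ₁⊗ψ₁ and φ₂⊗ψ₂.) -/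
open Filter Topology

/-- At most `|α| · 𝔠(φ, φ')` triples satisfy `(φ⊗ψ)(i, j) = (φ'⊗ψ')(i, k)`. -/
lemma ncard_prodCongr_eq_left_le {α : Type*} [Finite α] (φ ψ φ' ψ' : Equiv.Perm α) :
    {x : α × α × α | Equiv.prodCongr φ ψ (x.1, x.2.1) = Equiv.prodCongr φ' ψ' (x.1, x.2.2)}.ncard ≤
      Nat.card α * fixCount φ φ' := by
  rw [fixCount, ← Nat.card_prod, ← Nat.card_coe_set_eq]
  refine Nat.card_le_card_of_injective
    (fun x => (x.1.2.1, ⟨x.1.1, congrArg Prod.fst x.2⟩)) ?_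
  rintro ⟨⟨i, j, k⟩, hx⟩ ⟨⟨i', j', k'⟩, hy⟩ h
  obtain ⟨rfl, h⟩ := Prod.ext_iff.1 h
  obtain rfl := congrArg Subtype.val h
  obtain rfl : k = k' :=
    ψ'.injective ((congrArg Prod.snd hx).symm.trans (congrArg Prod.snd hy))
  rfl

/-- At most `|α| · 𝔠(ψ, ψ')` triples satisfy `(φ⊗ψ)(i, j) = (φ'⊗ψ')(k, j)`. -/
lemma ncard_prodCongr_eq_right_le {α : Type*} [Finite α] (φ ψ φ' ψ' : Equiv.Perm α) :
    {x : α × α × α | Equiv.prodCongr φ ψ (x.1, x.2.1) = Equiv.prodCongr φ' ψ' (x.2.2, x.2.1)}.ncard ≤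
      Nat.card α * fixCount ψ ψ' := by
  rw [fixCount, ← Nat.card_prod, ← Nat.card_coe_set_eq]
  refine Nat.card_le_card_of_injective
    (fun x => (x.1.1, ⟨x.1.2.1, congrArg Prod.snd x.2⟩)) ?_
  rintro ⟨⟨i, j, k⟩, hx⟩ ⟨⟨i', j', k'⟩, hy⟩ h
  obtain ⟨rfl, h⟩ := Prod.ext_iff.1 h
  obtain rfl := congrArg Subtype.val h
  obtain rfl : k = k' :=
    φ'.injective ((congrArg Prod.fst hx).symm.trans (congrArg Prod.fst hy))
  rfl

/-- for permutations `φ₁, ψ₁, φ₂, ψ₂` of `[N]`, the count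
`#{(i,j,k) : (φ₁⊗ψ₁)(i,j) ∈ {(φ₂⊗ψ₂)(i,k), (φ₂⊗ψ₂)(k,j), (ψ₂⊗φ₂)(i,k),
(ψ₂⊗φ₂)(k,j)}}` is at most `N·(𝔠(φ₁,φ₂) + 𝔠(φ₁,ψ₂) + 𝔠(ψ₁,φ₂) + 𝔠(ψ₁,ψ₂))`.
(Note `ψ₂⊗φ₂ = t∘(φ₂⊗ψ₂)∘t`, so this is the count of condition (ii) of the
main theorem for the pair `φ₁⊗ψ₁`, `φ₂⊗ψ₂`.) -/
theorem mixCount_tensor_le (N : ℕ) (hN : 0 < N) (φ₁ ψ₁ φ₂ ψ₂ : Equiv.Perm (Fin N)) :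
    Nat.card {x : Fin N × Fin N × Fin N //
        Equiv.prodCongr φ₁ ψ₁ (x.1, x.2.1) = Equiv.prodCongr φ₂ ψ₂ (x.1, x.2.2) ∨
        Equiv.prodCongr φ₁ ψ₁ (x.1, x.2.1) = Equiv.prodCongr φ₂ ψ₂ (x.2.2, x.2.1) ∨
        Equiv.prodCongr φ₁ ψ₁ (x.1, x.2.1) = Equiv.prodCongr ψ₂ φ₂ (x.1, x.2.2) ∨
        Equiv.prodCongr φ₁ ψ₁ (x.1, x.2.1) = Equiv.prodCongr ψ₂ φ₂ (x.2.2, x.2.1)} ≤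
      N * (fixCount φ₁ φ₂ + fixCount φ₁ ψ₂ + fixCount ψ₁ φ₂ + fixCount ψ₁ ψ₂) := by
  have h₁ := ncard_prodCongr_eq_left_le φ₁ ψ₁ φ₂ ψ₂
  have h₂ := ncard_prodCongr_eq_right_le φ₁ ψ₁ φ₂ ψ₂
  have h₃ := ncard_prodCongr_eq_left_le φ₁ ψ₁ ψ₂ φ₂
  have h₄ := ncard_prodCongr_eq_right_le φ₁ ψ₁ ψ₂ φ₂
  rw [Nat.card_fin] at h₁ h₂ h₃ h₄
  calc
    _ ≤ _ := (Set.ncard_union_le _ _).trans <| Nat.add_le_add h₁ <|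
      (Set.ncard_union_le _ _).trans <| Nat.add_le_add h₂ <|
      (Set.ncard_union_le _ _).trans <| Nat.add_le_add h₃ h₄
    _ = _ := by ring
end

section
/- For every positive integer N, the mixing-map permutation M_N of ([N]×[N])² satisfies 𝔧(M_N : M_N) ≤ N³, where 𝔧(M_N : M_N) = #{(x,y,z) ∈ ([N]×[N])³ : M_N(x,y) = (t∘M_N∘t)(z,y)}. In particular 𝔧(M_N : M_N)/(N²)² → 0 as N → ∞. -/
open Filter Topology

/-- The mixing-map permutation `M_N` of `([N]×[N])²`:
`M_N((a,b),(c,d)) = ((a,c),(b,d))`. -/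
def mixPerm (N : ℕ) : Equiv.Perm ((Fin N × Fin N) × (Fin N × Fin N)) :=
  Function.Involutive.toPerm
    (fun x => ((x.1.1, x.2.1), (x.1.2, x.2.2))) (fun _ => rfl)

theorem mixPerm_eq_conjT_iff {N : ℕ} (x y z : Fin N × Fin N) :
    mixPerm N (x, y) = conjT (mixPerm N) (z, y) ↔
      (x.1 = y.2 ∧ y.1 = z.2) ∧ x.2 = y.1 ∧ y.2 = z.1 := by
  simp [mixPerm, conjT, Function.Involutive.toPerm]

theorem jcount_mixPerm_le_sq (N : ℕ) : jcount (mixPerm N) (mixPerm N) ≤ N ^ 2 := by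
  have h : jcount (mixPerm N) (mixPerm N) ≤ Nat.card (Fin N × Fin N) := by
    refine Nat.card_le_card_of_injective (fun x => x.1.1) ?_
    rintro ⟨⟨x, y, z⟩, h⟩ ⟨⟨x', y', z'⟩, h'⟩ hx
    rw [mixPerm_eq_conjT_iff] at h h'
    ext <;> grind
  simpa [sq] using h

/-- the mixing map `M_N` satisfies `𝔧(M_N : M_N) ≤ N³`; in
particular `𝔧(M_N : M_N)/(N²)² → 0` as `N → ∞`. -/
theorem jcount_mixPerm_le :
    (∀ N : ℕ, 0 < N → jcount (mixPerm N) (mixPerm N) ≤ N ^ 3) ∧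
    Tendsto (fun N : ℕ =>
      (jcount (mixPerm N) (mixPerm N) : ℝ) / ((N : ℝ) ^ 2) ^ 2) atTop (nhds 0) := by
  refine ⟨fun N hN => (jcount_mixPerm_le_sq N).trans (Nat.pow_le_pow_right hN (by norm_num)), ?_⟩
  have hlim : Tendsto (fun N : ℕ => ((N : ℝ) ^ 2)⁻¹) atTop (nhds 0) :=
    tendsto_inv_atTop_zero.comp
      ((tendsto_pow_atTop two_ne_zero).comp tendsto_natCast_atTop_atTop)
  refine squeeze_zero (fun N => by positivity) (fun N => ?_) hlim
  have hle : (jcount (mixPerm N) (mixPerm N) : ℝ) ≤ (N : ℝ) ^ 2 := by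
    exact_mod_cast jcount_mixPerm_le_sq N
  calc (jcount (mixPerm N) (mixPerm N) : ℝ) / ((N : ℝ) ^ 2) ^ 2
      ≤ (N : ℝ) ^ 2 / ((N : ℝ) ^ 2) ^ 2 := by gcongr
    _ = ((N : ℝ) ^ 2)⁻¹ := by
      rcases eq_or_ne N 0 with rfl | hN
      · simp
      · field_simp
end

section
/- Let m be an even positive integer and for each positive integer N let τ_N be the permutation of (ℤ/Nℤ)² given by τ_N(i,j) = (i+j, j). For each k ∈ [m] fix a label c_k ∈ {id, τ, τ^t} and set σ_{k,N} = identity of (ℤ/Nℤ)², τ_N, or t∘τ_N∘t respectively. Let π be a noncrossing pair partition of [m] such that for some block {k,l} of π one has c_k = id and c_l ≠ id. Then V_N(π,(σ_{1,N},…,σ_{m,N})) → 0 as N → ∞. (This shows that the sufficient conditions of the main theorem are not necessary: the identity and τ_N fail condition (ii), yet the corresponding Gaussian matrices G_N and G_N^{τ_N} are still asymptotically free.) -/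
open Filter Topology

/-- The permutation `τ_N` of `(ℤ/Nℤ)²` given by `τ_N(i,j) = (i+j, j)`. -/
def tauPerm (N : ℕ) : Equiv.Perm (ZMod N × ZMod N) where
  toFun p := (p.1 + p.2, p.2)
  invFun p := (p.1 - p.2, p.2)
  left_inv p := by cases p; simp
  right_inv p := by cases p; simp

/-- In a fixed-point-free involution, the points placed before their partner by an injective
rank function are half of all points. -/
lemma two_mul_card_filter_rank_lt {ι : Type*} [Fintype ι] [DecidableEq ι] (π : Equiv.Perm ι)
    (hinv : ∀ k, π (π k) = k) (hfix : ∀ k, π k ≠ k) (r : ι → ℕ) (hr : Function.Injective r) :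
    2 * (Finset.univ.filter fun k => r k < r (π k)).card = Fintype.card ι := by
  have hcompl : (Finset.univ.filter fun k => r k < r (π k)).card =
      (Finset.univ.filter fun k => ¬ r k < r (π k)).card := by
    refine Finset.card_bij (fun k _ => π k) ?_ (fun _ _ _ _ h => π.injective h) ?_
    · intro k hk
      simp only [Finset.mem_filter, Finset.mem_univ, true_and, hinv] at hk ⊢
      exact hk.le.not_gt
    · intro k hk
      simp only [Finset.mem_filter, Finset.mem_univ, true_and] at hk
      refine ⟨π k, ?_, hinv k⟩
      simp only [Finset.mem_filter, Finset.mem_univ, true_and, hinv]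
      exact lt_of_le_of_ne (not_lt.mp hk) fun h => hfix k (hr h)
  have hsum := Finset.card_filter_add_card_filter_not (s := (Finset.univ : Finset ι))
    (fun k => r k < r (π k))
  rw [← hcompl, Finset.card_univ] at hsum
  omega

/-- If, among the tuples counted by `pairCount`, the entries at `e + 1` and `π e` determine the
entry at `π e + 1`, then one degree of freedom is lost compared to the trivial bound
`#α ^ (m / 2 + 1)`. -/
lemma pairCount_le_of_determined {α : Type*} [Fintype α] (n : ℕ)
    (π : Equiv.Perm (Fin (n + 1))) (hinv : ∀ k, π (π k) = k) (hfix : ∀ k, π k ≠ k)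
    (σ : Fin (n + 1) → Equiv.Perm (α × α)) (e : Fin (n + 1)) (g : α → α → α)
    (hdet : ∀ i : Fin (n + 1) → α,
      σ e (i e, i (e + 1)) = swapPair (σ (π e) (i (π e), i (π e + 1))) →
        i (π e + 1) = g (i (e + 1)) (i (π e))) :
    pairCount (n + 1) π σ ≤ Fintype.card α ^ ((n + 1) / 2) := by
  classical
  set r : Fin (n + 1) → ℕ := fun k => (k - (e + 1)).val with hrdef
  have hr : Function.Injective r := fun a b h => sub_left_injective (Fin.val_injective h)
  have hre : r e = n := by
    simp only [hrdef, sub_add_cancel_left, Fin.coe_neg_one]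
  have hrn : ∀ k, r k ≤ n := fun k => Nat.lt_succ_iff.mp (k - (e + 1)).isLt
  have hrsucc : ∀ k, k ≠ e → r (k + 1) = r k + 1 := by
    intro k hk
    have hlt : r k < n := lt_of_le_of_ne (hrn k) fun h => hk (hr (h.trans hre.symm))
    have hadd : k + 1 - (e + 1) = (k - (e + 1)) + 1 := add_sub_right_comm _ _ _
    simp only [hrdef, hadd]
    exact Fin.val_add_one_of_lt (Fin.lt_def.mpr hlt)
  set S := Finset.univ.filter fun k => r k < r (π k) with hS
  have hScard : 2 * S.card = n + 1 := by
    simpa using two_mul_card_filter_rank_lt π hinv hfix r hr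
  have hpe : π e ∈ S := by
    simp only [hS, Finset.mem_filter, Finset.mem_univ, true_and, hinv, hre]
    exact lt_of_le_of_ne (hrn _) fun h => hfix e (hr (h.trans hre.symm))
  set T := S.erase (π e) with hT
  have hTcard : T.card + 1 = S.card := Finset.card_erase_add_one hpe
  unfold pairCount
  simp only [finRotate_apply]
  let F : {i : Fin (n + 1) → α // ∀ k : Fin (n + 1),
      σ k (i k, i (k + 1)) = swapPair ((σ (π k)) (i (π k), i (π k + 1)))} → α × (T → α) :=
    fun i => (i.1 (e + 1), fun k => i.1 (k.1 + 1))
  have hF : Function.Injective F := by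
    rintro ⟨i, hi⟩ ⟨j, hj⟩ hij
    have h0 : i (e + 1) = j (e + 1) := congrArg Prod.fst hij
    have hfree : ∀ k ∈ T, i (k + 1) = j (k + 1) := fun k hk =>
      congrFun (congrArg Prod.snd hij) ⟨k, hk⟩
    have key : ∀ t k, r k = t → i k = j k := by
      intro t
      induction t using Nat.strong_induction_on with
      | _ t ih =>
        intro k hk
        obtain ⟨l, rfl⟩ : ∃ l, k = l + 1 := ⟨k - 1, (sub_add_cancel k 1).symm⟩
        by_cases hle : l = e
        · rw [hle, h0]
        have hlt : r l < t := by rw [← hk, hrsucc l hle]; exact Nat.lt_succ_self _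
        by_cases hlp : l = π e
        · subst hlp
          rw [hdet i (hi e), hdet j (hj e), h0, ih _ hlt _ rfl]
        by_cases hlS : r l < r (π l)
        · exact hfree l (by simp [hT, hS, hlp, hlS])
        have hpl : r (π l) < r l :=
          lt_of_le_of_ne (not_lt.mp hlS) fun h => hfix l (hr h)
        have hple : π l ≠ e := fun h => hlp (by rw [← h, hinv])
        have h1 : i (π l) = j (π l) := ih _ (hpl.trans hlt) _ rfl
        have h2 : i (π l + 1) = j (π l + 1) := by
          refine ih _ ?_ _ rfl
          rw [hrsucc _ hple]
          omega
        have h3 : σ l (i l, i (l + 1)) = σ l (j l, j (l + 1)) := by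
          rw [hi l, hj l, h1, h2]
        exact congrArg Prod.snd ((σ l).injective h3)
    exact Subtype.ext (funext fun k => key _ k rfl)
  calc _ ≤ Nat.card (α × (T → α)) := Nat.card_le_card_of_injective F hF
    _ = Fintype.card α ^ (T.card + 1) := by
      simp [Nat.card_eq_fintype_card, pow_succ, mul_comm]
    _ = _ := by congr 1; omega

/-- fix labels `c : [m] → {id, τ, τᵗ}` (here `Fin 3`, with
`0 = id`, `1 = τ`, `2 = τᵗ`) and set `σ_{k,N}` to be the identity of
`(ℤ/Nℤ)²`, `τ_N`, or `t∘τ_N∘t` accordingly. If `π` is a noncrossing pair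
partition of `[m]` having a block `{k, π k}` with `c k = id` and `c (π k) ≠ id`,
then `V_N(π, σ⃗_N) → 0` as `N → ∞`. (This shows the sufficient conditions of
the main theorem are not necessary: the identity and `τ_N` fail condition (ii),
yet `G_N` and `G_N^{τ_N}` are still asymptotically free.) -/
theorem Vval_tendsto_zero_id_tau (m : ℕ) (hm : Even m) (hm0 : 0 < m)
    (c : Fin m → Fin 3)
    (π : Equiv.Perm (Fin m)) (hinv : ∀ k, π (π k) = k) (hfix : ∀ k, π k ≠ k)
    (hnc : ∀ a b : Fin m, ¬(a < b ∧ b < π a ∧ π a < π b))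
    (k₀ : Fin m) (hk₀ : c k₀ = 0) (hk₀' : c (π k₀) ≠ 0) :
    Tendsto (fun N : ℕ =>
        (pairCount m π (fun k =>
          if c k = 0 then 1
          else if c k = 1 then tauPerm N
          else conjT (tauPerm N)) : ℝ) / (N : ℝ) ^ (m / 2 + 1))
      atTop (nhds 0) := by
  obtain ⟨n, rfl⟩ : ∃ n, m = n + 1 := ⟨m - 1, by omega⟩
  have hbound : ∀ N : ℕ, 0 < N → pairCount (n + 1) π (fun k =>
      if c k = 0 then 1 else if c k = 1 then tauPerm N else conjT (tauPerm N))
        ≤ N ^ ((n + 1) / 2) := by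
    intro N hN
    have : NeZero N := ⟨hN.ne'⟩
    by_cases h1 : c (π k₀) = 1
    · have h := pairCount_le_of_determined n π hinv hfix (fun k =>
        if c k = 0 then 1 else if c k = 1 then tauPerm N else conjT (tauPerm N)) k₀
        (fun x y => x - y) (by
          intro i hi
          simp only [hk₀, h1, if_true, one_ne_zero, if_false] at hi
          simp only [tauPerm, swapPair, Equiv.Perm.coe_one, id, Equiv.coe_fn_mk,
            Prod.mk.injEq] at hi
          rw [hi.2]; ring)
      rwa [ZMod.card] at h
    · have h := pairCount_le_of_determined n π hinv hfix (fun k =>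
        if c k = 0 then 1 else if c k = 1 then tauPerm N else conjT (tauPerm N)) (π k₀)
        (fun x y => y - x) (by
          intro i hi
          simp only [hinv, hk₀, hk₀', h1, if_true, if_false] at hi
          simp only [tauPerm, conjT, swapPair, Equiv.Perm.coe_one, id, Equiv.trans_apply,
            Equiv.prodComm_apply, Prod.swap, Equiv.coe_fn_mk, Prod.mk.injEq] at hi
          simp only [hinv]
          rw [← hi.1, ← hi.2]; ring)
      rwa [ZMod.card] at h
  refine squeeze_zero' (g := fun N : ℕ => (1 : ℝ) / N) (Eventually.of_forall fun N => by positivity)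
    ?_ tendsto_one_div_atTop_nhds_zero_nat
  filter_upwards [eventually_gt_atTop 0] with N hN
  have hN' : (0 : ℝ) < N := by exact_mod_cast hN
  rw [div_le_div_iff₀ (by positivity) hN', one_mul, pow_succ]
  gcongr
  exact_mod_cast hbound N hN
end
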